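/- Let O be a consistent L-theory and ψ an L-sentence such that O ⊭ ψ and O ∪ {ψ} is consistent. Let V be a finite uniform interpolant of O ∪ {¬ψ} for S_A, let V* = {β_1, …, β_n} with n ≥ 1 be the result of single-pass redundancy elimination applied to V with respect to O, and let H = ¬β_1 ∨ … ∨ ¬β_n. Then: (i) O ∪ {H} is consistent; (ii) O ∪ {H} ⊨ ψ; and (iii) for every i with 1 ≤ i ≤ n, O ∪ {¬β_i} ⊭ ¬β_1 ∨ … ∨ ¬β_{i−1} ∨ ¬β_{i+1} ∨ … ∨ ¬β_n (no inter-disjunct redundancy), where for n = 1 the empty disjunction is ⊥. -/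

import Mathlib

open FirstOrder Language

namespace Abduction

variable {L' L : FirstOrder.Language}

/-- An `L`-sentence is an `S_A`-sentence (w.r.t. the language homomorphism `ι`)
if it is the image under `ι` of some `L'`-sentence. -/
def IsSA (ι : L' →ᴸ L) (φ : L.Sentence) : Prop :=
  ∃ β : L'.Sentence, ι.onSentence β = φ

/-- `V` is a uniform interpolant of `O` for the abducible signature given by `ι`:
`V` is an `S_A`-theory and for every `S_A`-sentence `β`, `O ⊨ β` iff `V ⊨ β`. -/
def IsUniformInterpolant (ι : L' →ᴸ L) (O V : L.Theory) : Prop :=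
  (∀ β ∈ V, IsSA ι β) ∧ ∀ φ : L.Sentence, IsSA ι φ → ((O ⊨ᵇ φ) ↔ (V ⊨ᵇ φ))

/-- Finite disjunction `b 0 ∨ ... ∨ b (n-1)`; the empty disjunction is `⊥`. -/
def disj {L : FirstOrder.Language} : {n : ℕ} → (Fin n → L.Sentence) → L.Sentence
  | 0, _ => ⊥
  | _ + 1, b => b 0 ⊔ disj fun i => b i.succ

/-- Disjunction of a list of sentences; the empty disjunction is `⊥`. -/
def ldisj {L : FirstOrder.Language} : List L.Sentence → L.Sentence
  | [] => ⊥
  | φ :: rest => φ ⊔ ldisj rest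

open Classical in
/-- Single-pass redundancy elimination: go through the enumeration, removing an axiom
if it is entailed by `O` together with the remaining axioms. -/
noncomputable def spre (O : L.Theory) : List L.Sentence → L.Theory → L.Theory
  | [], R => R
  | β :: rest, R => spre O rest (if (O ∪ (R \ {β})) ⊨ᵇ β then R \ {β} else R)


theorem spre_subset (O : L.Theory) (l : List L.Sentence) (R : L.Theory) : spre O l R ⊆ R := by
  induction l generalizing R with
  | nil => exact subset_rfl
  | cons β rest ih =>
    refine (ih _).trans ?_
    split_ifs
    · exact Set.sdiff_subset
    · exact subset_rfl

theorem models_mono {T T' : L.Theory} {φ : L.Sentence} (hT : T ⊆ T') (h : T ⊨ᵇ φ) : T' ⊨ᵇ φ :=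
  Theory.models_of_models_theory (fun _ hψ => Theory.models_sentence_of_mem (hT hψ)) h

/-- No processed sentence that survives single-pass redundancy elimination is entailed by the
background theory together with the other survivors. -/
theorem not_models_of_mem_spre {O : L.Theory} {l : List L.Sentence} {R : L.Theory}
    {β : L.Sentence} (hl : β ∈ l) (h : β ∈ spre O l R) :
    ¬ ((O ∪ (spre O l R \ {β})) ⊨ᵇ β) := by
  induction l generalizing R with
  | nil => simp at hl
  | cons α rest ih =>
    rcases List.mem_cons.1 hl with rfl | hl
    · rw [spre] at h ⊢
      split_ifs at h ⊢ with hr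
      · exact absurd rfl (spre_subset _ _ _ h).2
      · exact mt (models_mono (Set.union_subset_union_right _
          (Set.sdiff_subset_sdiff_left (spre_subset _ _ _)))) hr
    · exact ih hl h

theorem realize_disj {M : Type*} [L.Structure M] {n : ℕ} (b : Fin n → L.Sentence) :
    M ⊨ disj b ↔ ∃ i, M ⊨ b i := by
  induction n with
  | zero => simp [disj, Sentence.not_realize_bot]
  | succ n ih =>
    rw [Fin.exists_fin_succ, ← ih, disj]
    exact Sentence.realize_sup M

theorem realize_ldisj {M : Type*} [L.Structure M] (l : List L.Sentence) :
    M ⊨ ldisj l ↔ ∃ φ ∈ l, M ⊨ φ := by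
  induction l with
  | nil => simp [ldisj, Sentence.not_realize_bot]
  | cons φ l ih =>
    rw [List.exists_mem_cons_iff, ← ih, ldisj]
    exact Sentence.realize_sup M

theorem model_union_singleton {M : Type*} [L.Structure M] {O : L.Theory} {φ : L.Sentence}
    (hO : M ⊨ O) (hφ : M ⊨ φ) : M ⊨ O ∪ {φ} :=
  hO.union (Theory.model_singleton_iff.2 hφ)

/-- Soundness of the abduction method: the hypothesis obtained by negating the
result of single-pass redundancy elimination applied to a uniform interpolant of `O ∪ {¬ψ}`
is consistent with `O`, explains `ψ`, and has no inter-disjunct redundancy. -/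
theorem abduction_soundness
    (ι : L' →ᴸ L) (O : L.Theory) (ψ : L.Sentence)
    (hO : Theory.IsSatisfiable O) (hne : ¬ (O ⊨ᵇ ψ))
    (hcons : Theory.IsSatisfiable (O ∪ {ψ}))
    (l : List L.Sentence) (V : L.Theory) (hnd : l.Nodup) (hV : V = {φ | φ ∈ l})
    (hUI : IsUniformInterpolant ι (O ∪ {ψ.not}) V)
    (n : ℕ) (hn : 1 ≤ n) (b : Fin n → L.Sentence) (hinj : Function.Injective b)
    (hVstar : Set.range b = spre O l V) :
    Theory.IsSatisfiable (O ∪ {disj fun i => (b i).not}) ∧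
      ((O ∪ {disj fun i => (b i).not}) ⊨ᵇ ψ) ∧
      ∀ i : Fin n, ¬ ((O ∪ {(b i).not}) ⊨ᵇ
        ldisj ((((List.finRange n).filter fun j => j ≠ i)).map fun j => (b j).not)) := by
  have hmem (i : Fin n) : b i ∈ spre O l V := hVstar ▸ Set.mem_range_self i
  have hnot (i : Fin n) : ¬ ((O ∪ (spre O l V \ {b i})) ⊨ᵇ b i) := by
    refine not_models_of_mem_spre ?_ (hmem i)
    have hiV := spre_subset _ _ _ (hmem i)
    rwa [hV] at hiV
  simp only [Theory.models_sentence_iff, not_forall] at hnot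
  choose M hM using hnot
  have hMO (i : Fin n) : M i ⊨ O := (M i).is_model.mono Set.subset_union_left
  have hrest {i j : Fin n} (hj : j ≠ i) : M i ⊨ b j :=
    Theory.realize_sentence_of_mem (O ∪ (spre O l V \ {b i})) (Or.inr ⟨hmem j, hinj.ne hj⟩)
  refine ⟨?_, ?_, fun i hi => ?_⟩
  · have := model_union_singleton (hMO ⟨0, hn⟩)
      ((realize_disj fun i => (b i).not).2 ⟨_, (Sentence.realize_not _).2 (hM ⟨0, hn⟩)⟩)
    exact Theory.Model.isSatisfiable (M ⟨0, hn⟩)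
  · rw [Theory.models_sentence_iff]
    intro M
    by_contra hψ
    have hH : M ⊨ disj fun i => (b i).not :=
      Theory.realize_sentence_of_mem (O ∪ {disj fun i => (b i).not}) (Or.inr rfl)
    obtain ⟨i, hi⟩ := (realize_disj _).1 hH
    refine (Sentence.realize_not M).1 hi ?_
    have hiV : b i ∈ V := spre_subset _ _ _ (hmem i)
    have hent := (hUI.2 _ (hUI.1 _ hiV)).2 (Theory.models_sentence_of_mem hiV)
    have := model_union_singleton (M.is_model.mono Set.subset_union_left : M ⊨ O)
      ((Sentence.realize_not M).2 hψ)
    exact hent.realize_sentence M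
  · have := model_union_singleton (hMO i) ((Sentence.realize_not _).2 (hM i))
    obtain ⟨φ, hφ, hMφ⟩ := (realize_ldisj _).1 (hi.realize_sentence (M i))
    simp only [List.mem_map, List.mem_filter, List.mem_finRange, true_and,
      decide_eq_true_eq] at hφ
    obtain ⟨j, hj, rfl⟩ := hφ
    exact (Sentence.realize_not _).1 hMφ (hrest hj)

end Abduction
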